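/- Suppose 𝒢 is a symmetric and connected weighted graph on n nodes and θ is an interpolation function. Let (p,v) and (z,u) be solutions of the graph continuity equation on [0,1], and suppose z_t ∈ (𝒫(𝒢))° for all t ∈ [0,1]. For a ∈ (0,1) define p^a_t := (1−a)p_t + a z_t. Then there exists v^a such that (p^a, v^a) solves the graph continuity equation on [0,1] and, for all t ∈ [0,1] and a ∈ (0,1): ‖v^a_t‖²_{Tan_{p^a_t}} ≤ (1−a)‖v_t‖²_{Tan_{p_t}} + a‖u_t‖²_{Tan_{z_t}}. -/

import Mathlib

open MeasureTheory Set Filter Topology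
open scoped ENNReal NNReal

noncomputable section

attribute [local instance] Classical.propDecidable

namespace VVOT

/-- `ℝ^d` with the Euclidean norm. -/
abbrev Euc (d : ℕ) := EuclideanSpace ℝ (Fin d)

/-- Reinterpret a plain function as an element of Euclidean space. -/
def toEuc (d : ℕ) (f : Fin d → ℝ) : Euc d := (WithLp.equiv 2 (Fin d → ℝ)).symm f

/-! ### Interpolation functions (Assumption 1.1) -/

structure IsInterpolation (θ : ℝ → ℝ → ℝ) : Prop where
  nonneg : ∀ s t : ℝ, 0 ≤ s → 0 ≤ t → 0 ≤ θ s t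
  contOn : ContinuousOn (fun p : ℝ × ℝ => θ p.1 p.2) {p : ℝ × ℝ | 0 ≤ p.1 ∧ 0 ≤ p.2}
  smoothOn : ContDiffOn ℝ (⊤ : ℕ∞) (fun p : ℝ × ℝ => θ p.1 p.2) {p : ℝ × ℝ | 0 < p.1 ∧ 0 < p.2}
  symm : ∀ s t : ℝ, 0 ≤ s → 0 ≤ t → θ s t = θ t s
  pos : ∀ s t : ℝ, 0 < s → 0 < t → 0 < θ s t
  normalized : θ 1 1 = 1
  mono : ∀ r s t : ℝ, 0 ≤ r → r ≤ s → 0 ≤ t → θ r t ≤ θ s t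
  homog : ∀ lam s t : ℝ, 0 < lam → 0 ≤ s → 0 ≤ t → θ (lam * s) (lam * t) = lam * θ s t
  concave : ConcaveOn ℝ {p : ℝ × ℝ | 0 ≤ p.1 ∧ 0 ≤ p.2} (fun p : ℝ × ℝ => θ p.1 p.2)

/-! ### Weighted graphs -/

/-- A symmetric connected weighted graph on `n` nodes. -/
structure IsGoodGraph (n : ℕ) (q : Fin n → Fin n → ℝ) : Prop where
  nonneg : ∀ i j, 0 ≤ q i j
  symm : ∀ i j, q i j = q j i
  connected : ∀ i j, Relation.ReflTransGen (fun a b => 0 < q a b) i j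

/-- `𝒫(𝒢)`, the probability simplex in `ℝⁿ`. -/
def probSimplex (n : ℕ) : Set (Fin n → ℝ) :=
  {p | (∀ i, 0 ≤ p i) ∧ ∑ i, p i = 1}

/-- The relative interior `(𝒫(𝒢))°`. -/
def probSimplexInt (n : ℕ) : Set (Fin n → ℝ) :=
  {p | (∀ i, 0 < p i) ∧ ∑ i, p i = 1}

/-! ### Graph continuity equation and the graph Wasserstein distance -/

/-- The mutation term `(1/2) Σ_j θ(p_i,p_j)(v_{ij}-v_{ji}) q_{ij}`. -/
def graphRHS (n : ℕ) (q : Fin n → Fin n → ℝ) (θ : ℝ → ℝ → ℝ)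
    (p : Fin n → ℝ) (v : Fin n → Fin n → ℝ) (i : Fin n) : ℝ :=
  (1 / 2) * ∑ j, θ (p i) (p j) * (v i j - v j i) * q i j

/-- A solution `(p, v)` of the graph continuity equation on `[0, T]`. -/
structure GraphCE (n : ℕ) (q : Fin n → Fin n → ℝ) (θ : ℝ → ℝ → ℝ) (T : ℝ)
    (p : ℝ → Fin n → ℝ) (v : ℝ → Fin n → Fin n → ℝ) : Prop where
  cont : ContinuousOn p (Icc 0 T)
  mem : ∀ t ∈ Icc (0:ℝ) T, p t ∈ probSimplex n
  meas : ∀ i j, Measurable fun t => v t i j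
  locInt : ∀ i j, LocallyIntegrableOn (fun t => θ (p t i) (p t j) * v t i j) (Ioo 0 T)
  weak : ∀ (i : Fin n) (φ : ℝ → ℝ), ContDiff ℝ (⊤ : ℕ∞) φ → HasCompactSupport φ →
    tsupport φ ⊆ Ioo 0 T →
    ∫ t in Ioo 0 T, deriv φ t * p t i = - ∫ t in Ioo 0 T, φ t * graphRHS n q θ (p t) (v t) i

/-- The squared tangent norm `‖v‖²_{Tan_p}`. -/
def tanNormSq (n : ℕ) (q : Fin n → Fin n → ℝ) (θ : ℝ → ℝ → ℝ)
    (p : Fin n → ℝ) (v : Fin n → Fin n → ℝ) : ℝ :=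
  (1 / 2) * ∑ i, ∑ j, (v i j) ^ 2 * θ (p i) (p j) * q i j

/-- The admissible kinetic energies between `p₀` and `p₁`. -/
def WGsqSet (n : ℕ) (q : Fin n → Fin n → ℝ) (θ : ℝ → ℝ → ℝ)
    (p₀ p₁ : Fin n → ℝ) : Set ℝ :=
  {A | ∃ p v, GraphCE n q θ 1 p v ∧ p 0 = p₀ ∧ p 1 = p₁ ∧
    A = ∫ t in Ioo (0:ℝ) 1, tanNormSq n q θ (p t) (v t)}

/-- The graph Wasserstein distance `W_𝒢`. -/
def WG (n : ℕ) (q : Fin n → Fin n → ℝ) (θ : ℝ → ℝ → ℝ) (p₀ p₁ : Fin n → ℝ) : ℝ :=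
  Real.sqrt (sInf (WGsqSet n q θ p₀ p₁))

/-! ### The simplex `Δ^{n-1}` and the lifted space `ℝ^d × Δ^{n-1}` -/

/-- `Δ^{n-1} ⊆ ℝ^{n-1}`. -/
def simplexSet (n : ℕ) : Set (Fin (n - 1) → ℝ) :=
  {r | (∀ i, 0 ≤ r i) ∧ ∑ i, r i ≤ 1}

/-- The interior `(Δ^{n-1})°`. -/
def simplexInt (n : ℕ) : Set (Fin (n - 1) → ℝ) :=
  {r | (∀ i, 0 < r i) ∧ ∑ i, r i < 1}

/-- `Δ^{n-1}_c`, the points of the simplex at distance `≥ c` from the boundary. -/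
def simplexC (n : ℕ) (c : ℝ) : Set (Fin (n - 1) → ℝ) :=
  {r | (∀ j, c ≤ r j) ∧ ∑ j, r j ≤ 1 - c}

/-- The bijection `𝐩 : Δ^{n-1} → 𝒫(𝒢)`. -/
def pmap (n : ℕ) (r : Fin (n - 1) → ℝ) : Fin n → ℝ :=
  fun i => if h : (i : ℕ) < n - 1 then r ⟨i, h⟩ else 1 - ∑ j, r j

/-- The induced distance `d_{Δ^{n-1}}` on the simplex. -/
def dDelta (n : ℕ) (q : Fin n → Fin n → ℝ) (θ : ℝ → ℝ → ℝ)
    (r r' : Fin (n - 1) → ℝ) : ℝ :=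
  WG n q θ (pmap n r) (pmap n r')

/-- The lifted space `ℝ^d × Δ^{n-1}` (as an ambient type). -/
abbrev Lift (d n : ℕ) := Euc d × (Fin (n - 1) → ℝ)

/-- The squared ground distance on `ℝ^d × Δ^{n-1}`. -/
def groundDistSq (d n : ℕ) (q : Fin n → Fin n → ℝ) (θ : ℝ → ℝ → ℝ)
    (z z' : Lift d n) : ℝ :=
  ‖z.1 - z'.1‖ ^ 2 + (dDelta n q θ z.2 z'.2) ^ 2

/-- A coupling of two measures. -/
def IsCoupling {X : Type*} [MeasurableSpace X] (μ ν : Measure X)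
    (Γ : Measure (X × X)) : Prop :=
  Γ.map Prod.fst = μ ∧ Γ.map Prod.snd = ν

/-- The transport cost of a plan on the lifted space. -/
def couplingCost (d n : ℕ) (q : Fin n → Fin n → ℝ) (θ : ℝ → ℝ → ℝ)
    (Γ : Measure (Lift d n × Lift d n)) : ℝ :=
  ∫ z, groundDistSq d n q θ z.1 z.2 ∂Γ

/-- The squared 2-Wasserstein distance `W²_{ℝ^d × Δ^{n-1}}`. -/
def WProdSq (d n : ℕ) (q : Fin n → Fin n → ℝ) (θ : ℝ → ℝ → ℝ)
    (μ ν : Measure (Lift d n)) : ℝ :=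
  sInf {A | ∃ Γ, IsCoupling μ ν Γ ∧ A = couplingCost d n q θ Γ}

/-- The 2-Wasserstein distance `W_{ℝ^d × Δ^{n-1}}`. -/
def WProd (d n : ℕ) (q : Fin n → Fin n → ℝ) (θ : ℝ → ℝ → ℝ)
    (μ ν : Measure (Lift d n)) : ℝ :=
  Real.sqrt (WProdSq d n q θ μ ν)

/-- Membership in `𝒫(ℝ^d × Δ^{n-1})`. -/
def MemLift (d n : ℕ) (lam : Measure (Lift d n)) : Prop :=
  IsProbabilityMeasure lam ∧ lam {z : Lift d n | z.2 ∉ simplexSet n} = 0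

/-- Membership in `𝒫₂(ℝ^d × Δ^{n-1})` (finite second moment). -/
def MemLift2 (d n : ℕ) (lam : Measure (Lift d n)) : Prop :=
  MemLift d n lam ∧ (∫⁻ z : Lift d n, ENNReal.ofReal (‖z.1‖ ^ 2) ∂lam) < ⊤

/-- The projection `𝔓 : 𝒫(ℝ^d × Δ^{n-1}) → 𝒫(ℝ^d × 𝒢)`,
`(𝔓λ)_j(A) = ∫_{A × Δ^{n-1}} 𝐩_j(r) dλ(x,r)`. -/
def liftProj (d n : ℕ) (lam : Measure (Lift d n)) (j : Fin n) : Measure (Euc d) :=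
  (lam.withDensity fun z => ENNReal.ofReal (pmap n z.2 j)).map Prod.fst

/-- The vertex `e_j` of the simplex, with `𝐩(e_j) = δ_j`. -/
def corner (n : ℕ) (j : Fin n) : Fin (n - 1) → ℝ :=
  fun i => if (i : ℕ) = (j : ℕ) then 1 else 0

/-- The canonical lift `λ_μ = Σ_j μ_j ⊗ δ_{e_j}`. -/
def canonicalLift (d n : ℕ) (μ : Fin n → Measure (Euc d)) : Measure (Lift d n) :=
  ∑ j, (μ j).prod (Measure.dirac (corner n j))

/-- The static distance `W_{2,𝒲}`. -/
def W2W (d n : ℕ) (q : Fin n → Fin n → ℝ) (θ : ℝ → ℝ → ℝ)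
    (μ ν : Fin n → Measure (Euc d)) : ℝ :=
  WProd d n q θ (canonicalLift d n μ) (canonicalLift d n ν)

/-- The admissible values in the definition of the semimetric `D_{ℝ^d × 𝒢}`. -/
def DSet (d n : ℕ) (q : Fin n → Fin n → ℝ) (θ : ℝ → ℝ → ℝ)
    (μ ν : Fin n → Measure (Euc d)) : Set ℝ :=
  {A | ∃ l₁ l₂ : Measure (Lift d n), MemLift d n l₁ ∧ MemLift d n l₂ ∧
    (∀ j, liftProj d n l₁ j = μ j) ∧ (∀ j, liftProj d n l₂ j = ν j) ∧
    A = WProd d n q θ l₁ l₂}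

/-- The static semimetric `D_{ℝ^d × 𝒢}`. -/
def Ddist (d n : ℕ) (q : Fin n → Fin n → ℝ) (θ : ℝ → ℝ → ℝ)
    (μ ν : Fin n → Measure (Euc d)) : ℝ :=
  sInf (DSet d n q θ μ ν)

/-! ### Vector valued measures -/

/-- Membership in `𝒫(Ω × 𝒢)`: an `n`-tuple of finite nonnegative Borel measures supported
on `Ω` whose total masses add up to `1`. -/
structure MemVV (d n : ℕ) (Ω : Set (Euc d)) (μ : Fin n → Measure (Euc d)) : Prop where
  finite : ∀ i, IsFiniteMeasure (μ i)
  support : ∀ i, μ i Ωᶜ = 0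
  total : (∑ i, μ i Set.univ) = 1

/-- Membership in `𝒫₂(Ω × 𝒢)` (finite second moments). -/
def MemVV2 (d n : ℕ) (Ω : Set (Euc d)) (μ : Fin n → Measure (Euc d)) : Prop :=
  MemVV d n Ω μ ∧ ∀ i, (∫⁻ x, ENNReal.ofReal (‖x‖ ^ 2) ∂(μ i)) < ⊤

/-- `μ̄ = Σ_i μ_i`. -/
def rbar (d n : ℕ) (μ : Fin n → Measure (Euc d)) : Measure (Euc d) := ∑ i, μ i

/-- The Radon–Nikodym derivative `dμ_i/dμ̄` as a real valued function. -/
def rnd (d n : ℕ) (μ : Fin n → Measure (Euc d)) (i : Fin n) (x : Euc d) : ℝ :=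
  ((μ i).rnDeriv (rbar d n μ) x).toReal

/-! ### The vector valued continuity equation -/

/-- A solution `(ρ, u, v)` of the vector valued continuity equation on `[t₀, t₁]`. -/
structure VVCE (d n : ℕ) (q : Fin n → Fin n → ℝ) (θ : ℝ → ℝ → ℝ) (Ω : Set (Euc d))
    (t₀ t₁ : ℝ) (ρ : ℝ → Fin n → Measure (Euc d))
    (u : ℝ → Fin n → Euc d → Euc d) (v : ℝ → Fin n → Fin n → Euc d → ℝ) : Prop where
  mem : ∀ t ∈ Icc t₀ t₁, MemVV d n Ω (ρ t)
  narrow : ∀ (i : Fin n) (f : BoundedContinuousFunction (Euc d) ℝ),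
    ContinuousOn (fun t => ∫ x, f x ∂(ρ t i)) (Icc t₀ t₁)
  measU : ∀ i, Measurable (Function.uncurry fun t x => u t i x)
  measV : ∀ i j, Measurable (Function.uncurry fun t x => v t i j x)
  intU : ∀ i, (∫⁻ t in Icc t₀ t₁, ∫⁻ x, ENNReal.ofReal ‖u t i x‖ ∂(ρ t i)) < ⊤
  intV : ∀ i j, (∫⁻ t in Icc t₀ t₁, ∫⁻ x,
      ENNReal.ofReal (|v t i j x| * θ (rnd d n (ρ t) i x) (rnd d n (ρ t) j x))
        ∂(rbar d n (ρ t))) < ⊤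
  weak : ∀ (i : Fin n) (η : Euc d × ℝ → ℝ), ContDiff ℝ (⊤ : ℕ∞) η →
    HasCompactSupport η → (∀ z : Euc d × ℝ, z.2 ∉ Ioo t₀ t₁ → η z = 0) →
    ∫ t in Ioo t₀ t₁, ∫ x, deriv (fun s => η (x, s)) t ∂(ρ t i) =
      - (∫ t in Ioo t₀ t₁, ∫ x, fderiv ℝ (fun y => η (y, t)) x (u t i x) ∂(ρ t i))
      - (1 / 2) * ∑ j, ∫ t in Ioo t₀ t₁, ∫ x,
          η (x, t) * θ (rnd d n (ρ t) i x) (rnd d n (ρ t) j x) *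
            (v t i j x - v t j i x) * q i j ∂(rbar d n (ρ t))

/-- The action `‖(u,v)‖²_ρ`. -/
def action (d n : ℕ) (q : Fin n → Fin n → ℝ) (θ : ℝ → ℝ → ℝ)
    (ρ : Fin n → Measure (Euc d)) (u : Fin n → Euc d → Euc d)
    (v : Fin n → Fin n → Euc d → ℝ) : ℝ :=
  (∑ i, ∫ x, ‖u i x‖ ^ 2 ∂(ρ i)) +
    (1 / 2) * ∑ i, ∑ j, ∫ x,
      (v i j x) ^ 2 * θ (rnd d n ρ i x) (rnd d n ρ j x) * q i j ∂(rbar d n ρ)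

/-- The set of total actions of curves in `𝒞(μ, ν)`. -/
def dynCostSet (d n : ℕ) (q : Fin n → Fin n → ℝ) (θ : ℝ → ℝ → ℝ) (Ω : Set (Euc d))
    (μ ν : Fin n → Measure (Euc d)) : Set ℝ :=
  {A | ∃ ρ u v, VVCE d n q θ Ω 0 1 ρ u v ∧ ρ 0 = μ ∧ ρ 1 = ν ∧
    A = ∫ t in Ioo (0:ℝ) 1, action d n q θ (ρ t) (u t) (v t)}

/-- The squared dynamic distance `W²_{Ω × 𝒢}`. -/
def WOmegaSq (d n : ℕ) (q : Fin n → Fin n → ℝ) (θ : ℝ → ℝ → ℝ) (Ω : Set (Euc d))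
    (μ ν : Fin n → Measure (Euc d)) : ℝ :=
  sInf (dynCostSet d n q θ Ω μ ν)

/-- The dynamic distance `W_{Ω × 𝒢}`. -/
def WOmega (d n : ℕ) (q : Fin n → Fin n → ℝ) (θ : ℝ → ℝ → ℝ) (Ω : Set (Euc d))
    (μ ν : Fin n → Measure (Euc d)) : ℝ :=
  Real.sqrt (WOmegaSq d n q θ Ω μ ν)

/-! ### The bounded Lipschitz distance -/

/-- Admissible test functions: `η ∈ C_c^∞(ℝ^d)` with `‖η‖²_∞ + ‖∇η‖²_∞ ≤ 1`. -/
def BLtest (d : ℕ) : Set (Euc d → ℝ) :=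
  {η | ContDiff ℝ (⊤ : ℕ∞) η ∧ HasCompactSupport η ∧
    ∃ c₁ c₂ : ℝ, (∀ x, |η x| ≤ c₁) ∧ (∀ x, ‖fderiv ℝ η x‖ ≤ c₂) ∧ c₁ ^ 2 + c₂ ^ 2 ≤ 1}

/-- The bounded Lipschitz norm `‖μ - ν‖_BL` of a difference of finite measures. -/
def BLnorm (d : ℕ) (μ ν : Measure (Euc d)) : ℝ :=
  sSup {A | ∃ η ∈ BLtest d, A = (∫ x, η x ∂μ) - ∫ x, η x ∂ν}

/-- The bounded Lipschitz distance `d_BL` on vector valued measures. -/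
def dBL (d n : ℕ) (μ ν : Fin n → Measure (Euc d)) : ℝ :=
  Real.sqrt (∑ i, (BLnorm d (μ i) (ν i)) ^ 2)

/-! ### Absolutely continuous curves and metric derivatives -/

/-- `γ ∈ AC(0,1;X)` with respect to a distance function `dist`. -/
def IsACCurve {X : Type*} (dist : X → X → ℝ) (γ : ℝ → X) : Prop :=
  ∃ m : ℝ → ℝ, IntegrableOn m (Ioo 0 1) ∧
    ∀ s t : ℝ, 0 < s → s ≤ t → t < 1 → dist (γ s) (γ t) ≤ ∫ r in s..t, m r

/-- `L` is the metric derivative of `γ` at `t`. -/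
def HasMetricDeriv {X : Type*} (dist : X → X → ℝ) (γ : ℝ → X) (t L : ℝ) : Prop :=
  Tendsto (fun s => dist (γ s) (γ t) / |s - t|) (nhdsWithin t {t}ᶜ) (nhds L)

/-! ### The convex functions `α`, `β` associated to `θ` -/

/-- `α(t,s,x)` with values in `[0,∞]`. -/
def alphaE (d : ℕ) (θ : ℝ → ℝ → ℝ) (t s : ℝ) (x : Euc d) : ℝ≥0∞ :=
  if 0 ≤ t ∧ 0 ≤ s then
    (if θ t s = 0 then (if x = 0 then 0 else ⊤) else ENNReal.ofReal (‖x‖ ^ 2 / θ t s))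
  else ⊤

/-- `β(a,b,c) = sup_{t,s ≥ 0} (a t + b s + (‖c‖²/4) θ(t,s))`, with values in `{0, ∞}`. -/
def betaE (d : ℕ) (θ : ℝ → ℝ → ℝ) (a b : ℝ) (c : Euc d) : ℝ≥0∞ :=
  ⨆ (t : ℝ) (s : ℝ) (_ : 0 ≤ t) (_ : 0 ≤ s),
    ENNReal.ofReal (a * t + b * s + ‖c‖ ^ 2 / 4 * θ t s)

/-- `K`, the effective domain of `β`. -/
def Kdom (d : ℕ) (θ : ℝ → ℝ → ℝ) : Set (ℝ × ℝ × Euc d) :=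
  {z | betaE d θ z.1 z.2.1 z.2.2 = 0}

/-! ### Signed measures -/

/-- Integration of a real function against a (finite) signed measure. -/
def intSigned {X : Type*} [MeasurableSpace X] (f : X → ℝ) (s : SignedMeasure X) : ℝ :=
  (∫ x, f x ∂s.toJordanDecomposition.posPart) - ∫ x, f x ∂s.toJordanDecomposition.negPart

/-- Absolute continuity of a signed measure with respect to a measure. -/
def SignedAC {X : Type*} [MeasurableSpace X] (s : SignedMeasure X) (μ : Measure X) : Prop :=
  ∀ A : Set X, MeasurableSet A → μ A = 0 → s A = 0

/-! ### The weighted graph Laplacian and its pseudoinverse -/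

/-- The four Moore–Penrose conditions. -/
def IsMoorePenrose {n : ℕ} (M X : Matrix (Fin n) (Fin n) ℝ) : Prop :=
  M * X * M = M ∧ X * M * X = X ∧ (M * X).transpose = M * X ∧ (X * M).transpose = X * M

/-- The Moore–Penrose pseudoinverse (when it exists; `0` otherwise). -/
def pinv {n : ℕ} (M : Matrix (Fin n) (Fin n) ℝ) : Matrix (Fin n) (Fin n) ℝ :=
  if h : ∃ X, IsMoorePenrose M X then h.choose else 0

/-- The `p`-weighted graph Laplacian `B(p)`. -/
def Bmat (n : ℕ) (q : Fin n → Fin n → ℝ) (θ : ℝ → ℝ → ℝ) (p : Fin n → ℝ) :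
    Matrix (Fin n) (Fin n) ℝ :=
  Matrix.of fun i j =>
    if i = j then ∑ k ∈ Finset.univ.erase i, θ (p i) (p k) * q i k
    else -(θ (p i) (p j) * q i j)

/-- The map `Ξ : ℝ^{n-1} → ℝⁿ`. -/
def Xi (n : ℕ) (f : Fin (n - 1) → ℝ) : Fin n → ℝ :=
  fun i => if h : (i : ℕ) < n - 1 then f ⟨i, h⟩ else -(∑ j, f j)

/-- The squared Riemannian tangent norm on `ℝ^d × (Δ^{n-1})°`:
`‖w‖² = |w₁|² + ⟨Ξw₂, B(𝐩(r))† Ξw₂⟩`. -/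
def liftTanSq (d n : ℕ) (q : Fin n → Fin n → ℝ) (θ : ℝ → ℝ → ℝ)
    (z : Lift d n) (w : Euc d × (Fin (n - 1) → ℝ)) : ℝ :=
  ‖w.1‖ ^ 2 + ∑ i, Xi n w.2 i * (pinv (Bmat n q θ (pmap n z.2))).mulVec (Xi n w.2) i

/-! ### Support of a measure and the continuity equation on the lifted space -/

/-- The (topological) support of a measure. -/
def msupport {X : Type*} [TopologicalSpace X] [MeasurableSpace X] (μ : Measure X) : Set X :=
  {x | ∀ U : Set X, IsOpen U → x ∈ U → 0 < μ U}

/-- A weak solution `(λ, w)` of the continuity equation on `ℝ^d × (Δ^{n-1})°` on `[0, T]`. -/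
structure LiftCE (d n : ℕ) (q : Fin n → Fin n → ℝ) (θ : ℝ → ℝ → ℝ) (T : ℝ)
    (lam : ℝ → Measure (Lift d n))
    (w : ℝ → Lift d n → Euc d × (Fin (n - 1) → ℝ)) : Prop where
  prob : ∀ t ∈ Icc (0:ℝ) T, IsProbabilityMeasure (lam t)
  narrow : ∀ f : BoundedContinuousFunction (Lift d n) ℝ,
    ContinuousOn (fun t => ∫ z, f z ∂(lam t)) (Icc 0 T)
  interior : ∀ t ∈ Icc (0:ℝ) T, msupport (lam t) ⊆ {z : Lift d n | z.2 ∈ simplexInt n}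
  measW : Measurable (Function.uncurry w)
  intW : (∫⁻ t in Icc (0:ℝ) T, ∫⁻ z,
      ENNReal.ofReal (Real.sqrt (liftTanSq d n q θ z (w t z))) ∂(lam t)) < ⊤
  weak : ∀ η : Lift d n × ℝ → ℝ, ContDiff ℝ (⊤ : ℕ∞) η → HasCompactSupport η →
    (∀ z : Lift d n × ℝ, z.2 ∉ Ioo 0 T → η z = 0) →
    ∫ t in Ioo (0:ℝ) T, ∫ z, deriv (fun s => η (z, s)) t ∂(lam t) =
      - ∫ t in Ioo (0:ℝ) T, ∫ z, fderiv ℝ (fun y => η (y, t)) z (w t z) ∂(lam t)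

/-! ### Linearized optimal transport -/

/-- The squared Euclidean norm on `ℝ^d × ℝ^{n-1}`. -/
def liftNormSq (d n : ℕ) (z : Lift d n) : ℝ := ‖z.1‖ ^ 2 + ∑ i, (z.2 i) ^ 2

/-- The linearized OT distance `d_LOT` induced by transport maps `T_μ` from `λ_ref`. -/
def dLOT (d n : ℕ) (T : (Fin n → Measure (Euc d)) → Lift d n → Lift d n)
    (lref : Measure (Lift d n)) (μ ν : Fin n → Measure (Euc d)) : ℝ :=
  Real.sqrt (∫ z, liftNormSq d n (T μ z - T ν z) ∂lref)

/-- The probability vector `δ_i ∈ 𝒫(𝒢)` concentrated at node `i`. -/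
def nodeDelta (n : ℕ) (i : Fin n) : Fin n → ℝ := fun j => if j = i then 1 else 0


/-! ### Convex combinations of solutions of the graph continuity equation -/

lemma IsInterpolation.continuousOn_comp {θ : ℝ → ℝ → ℝ} (hθ : IsInterpolation θ)
    {X : Type*} [TopologicalSpace X] {s : Set X} {f g : X → ℝ}
    (hf : ContinuousOn f s) (hg : ContinuousOn g s)
    (hf0 : ∀ x ∈ s, 0 ≤ f x) (hg0 : ∀ x ∈ s, 0 ≤ g x) :
    ContinuousOn (fun x => θ (f x) (g x)) s :=
  hθ.contOn.comp (hf.prodMk hg) fun x hx => ⟨hf0 x hx, hg0 x hx⟩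

lemma measurable_indicator_of_continuousOn {f : ℝ → ℝ} {s : Set ℝ} (hf : ContinuousOn f s)
    (hs : MeasurableSet s) : Measurable (s.indicator f) := by
  rw [← piecewise_eq_indicator]
  exact hf.measurable_piecewise continuousOn_const hs

lemma IsInterpolation.concave_le {θ : ℝ → ℝ → ℝ} (hθ : IsInterpolation θ) {a : ℝ}
    (ha0 : 0 ≤ a) (ha1 : a ≤ 1) {r s r' s' : ℝ}
    (hr : 0 ≤ r) (hs : 0 ≤ s) (hr' : 0 ≤ r') (hs' : 0 ≤ s') :
    (1 - a) * θ r s + a * θ r' s' ≤ θ ((1 - a) * r + a * r') ((1 - a) * s + a * s') := by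
  have h := hθ.concave.2 (x := (r, s)) (y := (r', s')) ⟨hr, hs⟩ ⟨hr', hs'⟩
    (sub_nonneg.2 ha1) ha0 (sub_add_cancel 1 a)
  simpa using h

/-- Joint convexity of `(m, x) ↦ x ^ 2 / m`, in terms of the velocities `x / m`. -/
lemma sq_div_mul_le {A B M x y : ℝ} (hA : 0 ≤ A) (hB : 0 ≤ B) (hM : 0 < M) (hABM : A + B ≤ M) :
    ((A * x + B * y) / M) ^ 2 * M ≤ A * x ^ 2 + B * y ^ 2 := by
  have hE : 0 ≤ A * x ^ 2 + B * y ^ 2 := by positivity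
  have hAB : 0 ≤ A * B * (x - y) ^ 2 := by positivity
  have heq : ((A * x + B * y) / M) ^ 2 * M = (A * x + B * y) ^ 2 / M := by
    field_simp
  rw [heq, div_le_iff₀ hM]
  nlinarith [mul_le_mul_of_nonneg_left hABM hE]

lemma graphRHS_eq_sum_flux {n : ℕ} {θ : ℝ → ℝ → ℝ} (hθ : IsInterpolation θ)
    (q : Fin n → Fin n → ℝ) {p : Fin n → ℝ} (hp : p ∈ probSimplex n)
    (v : Fin n → Fin n → ℝ) (i : Fin n) :
    graphRHS n q θ p v i =
      (1 / 2) * ∑ j, (θ (p i) (p j) * v i j - θ (p j) (p i) * v j i) * q i j := by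
  unfold graphRHS
  refine congrArg _ (Finset.sum_congr rfl fun j _ => ?_)
  rw [hθ.symm (p j) (p i) (hp.1 j) (hp.1 i)]
  ring

lemma GraphCE.integrableOn_mul_graphRHS {n : ℕ} {q : Fin n → Fin n → ℝ} {θ : ℝ → ℝ → ℝ}
    (hθ : IsInterpolation θ) {T : ℝ} {p : ℝ → Fin n → ℝ} {v : ℝ → Fin n → Fin n → ℝ}
    (h : GraphCE n q θ T p v) (i : Fin n) {φ : ℝ → ℝ} (hφ : Continuous φ)
    (hφc : HasCompactSupport φ) (hφs : tsupport φ ⊆ Ioo 0 T) :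
    IntegrableOn (fun t => φ t * graphRHS n q θ (p t) (v t) i) (Ioo 0 T) := by
  have hflux : ∀ j k, IntegrableOn (fun t => θ (p t j) (p t k) * v t j k) (tsupport φ) :=
    fun j k => (h.locInt j k).integrableOn_compact_subset hφs hφc
  have hRHS : IntegrableOn (fun t => graphRHS n q θ (p t) (v t) i) (tsupport φ) := by
    have hsum : IntegrableOn (fun t => (1 / 2) * ∑ j, (θ (p t i) (p t j) * v t i j
        - θ (p t j) (p t i) * v t j i) * q i j) (tsupport φ) :=
      (integrable_finsetSum _ fun j _ =>
        ((hflux i j).sub (hflux j i)).mul_const (q i j)).const_mul (1 / 2)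
    exact hsum.congr_fun (fun t ht =>
      (graphRHS_eq_sum_flux hθ q (h.mem t (Ioo_subset_Icc_self (hφs ht))) (v t) i).symm)
      (isClosed_tsupport φ).measurableSet
  have hprod := hRHS.continuousOn_mul hφ.continuousOn hφc
  refine Integrable.integrableOn ((integrableOn_iff_integrable_of_support_subset ?_).1 hprod)
  exact (Function.support_mul_subset_left _ _).trans (subset_tsupport φ)

lemma GraphCE.integrableOn_mul_apply {n : ℕ} {q : Fin n → Fin n → ℝ} {θ : ℝ → ℝ → ℝ}
    {T : ℝ} {p : ℝ → Fin n → ℝ} {v : ℝ → Fin n → Fin n → ℝ}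
    (h : GraphCE n q θ T p v) (i : Fin n) {ψ : ℝ → ℝ} (hψ : Continuous ψ) :
    IntegrableOn (fun t => ψ t * p t i) (Ioo 0 T) :=
  ((hψ.continuousOn.mul (continuousOn_pi.1 h.cont i)).integrableOn_Icc).mono_set
    Ioo_subset_Icc_self

lemma convexCombination_mem_probSimplex {n : ℕ} {a : ℝ} (ha0 : 0 ≤ a) (ha1 : a ≤ 1)
    {p z : Fin n → ℝ} (hp : p ∈ probSimplex n) (hz : z ∈ probSimplex n) :
    (1 - a) • p + a • z ∈ probSimplex n := by
  refine ⟨fun i => ?_, ?_⟩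
  · have := mul_nonneg (sub_nonneg.2 ha1) (hp.1 i)
    have := mul_nonneg ha0 (hz.1 i)
    simp only [Pi.add_apply, Pi.smul_apply, smul_eq_mul]
    positivity
  · simp [Finset.sum_add_distrib, ← Finset.mul_sum, hp.2, hz.2]

/-- A velocity whose flux along a convex combination of two solutions is the convex combination
of the fluxes solves the continuity equation. -/
lemma GraphCE.convexCombination {n : ℕ} {q : Fin n → Fin n → ℝ} {θ : ℝ → ℝ → ℝ}
    (hθ : IsInterpolation θ) {T : ℝ} {p z : ℝ → Fin n → ℝ} {v u w : ℝ → Fin n → Fin n → ℝ}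
    (hpv : GraphCE n q θ T p v) (hzu : GraphCE n q θ T z u) {a : ℝ} (ha0 : 0 ≤ a) (ha1 : a ≤ 1)
    (hw : ∀ i j, Measurable fun t => w t i j)
    (hflux : ∀ t ∈ Icc (0 : ℝ) T, ∀ i j,
      θ (((1 - a) • p t + a • z t) i) (((1 - a) • p t + a • z t) j) * w t i j =
        (1 - a) * (θ (p t i) (p t j) * v t i j) + a * (θ (z t i) (z t j) * u t i j)) :
    GraphCE n q θ T (fun t => (1 - a) • p t + a • z t) w where
  cont := (hpv.cont.const_smul (1 - a)).add (hzu.cont.const_smul a)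
  mem t ht := convexCombination_mem_probSimplex ha0 ha1 (hpv.mem t ht) (hzu.mem t ht)
  meas := hw
  locInt i j := by
    have hsum := ((hpv.locInt i j).smul (1 - a)).add ((hzu.locInt i j).smul a)
    rw [locallyIntegrableOn_iff isOpen_Ioo.isLocallyClosed] at hsum ⊢
    intro K hK hKc
    refine (hsum K hK hKc).congr_fun (fun t ht => ?_) hKc.measurableSet
    simpa using (hflux t (Ioo_subset_Icc_self (hK ht)) i j).symm
  weak i φ hφ hφc hφs := by
    have hRHS : ∀ t ∈ Ioo (0 : ℝ) T,
        φ t * graphRHS n q θ ((1 - a) • p t + a • z t) (w t) i =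
          (1 - a) * (φ t * graphRHS n q θ (p t) (v t) i) +
            a * (φ t * graphRHS n q θ (z t) (u t) i) := by
      intro t ht
      have ht' := Ioo_subset_Icc_self ht
      rw [graphRHS_eq_sum_flux hθ q (hpv.mem t ht'), graphRHS_eq_sum_flux hθ q (hzu.mem t ht'),
        graphRHS_eq_sum_flux hθ q
          (convexCombination_mem_probSimplex ha0 ha1 (hpv.mem t ht') (hzu.mem t ht'))]
      simp only [hflux t ht']
      simp only [Finset.mul_sum, ← Finset.sum_add_distrib]
      exact Finset.sum_congr rfl fun j _ => by ring
    have hLHS : ∀ t, deriv φ t * ((1 - a) • p t + a • z t) i =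
        (1 - a) * (deriv φ t * p t i) + a * (deriv φ t * z t i) := by
      intro t
      simp only [Pi.add_apply, Pi.smul_apply, smul_eq_mul]
      ring
    have hφ' : Continuous (deriv φ) := hφ.continuous_deriv (by simp)
    rw [setIntegral_congr_fun measurableSet_Ioo hRHS]
    simp only [hLHS]
    rw [integral_add ((hpv.integrableOn_mul_apply i hφ').const_mul _)
        ((hzu.integrableOn_mul_apply i hφ').const_mul _),
      integral_add ((hpv.integrableOn_mul_graphRHS hθ i hφ.continuous hφc hφs).const_mul _)
        ((hzu.integrableOn_mul_graphRHS hθ i hφ.continuous hφc hφs).const_mul _)]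
    simp only [integral_const_mul]
    rw [hpv.weak i φ hφ hφc hφs, hzu.weak i φ hφ hφc hφs]
    ring

/-- Lemma 2.7: convex combinations of solutions of the graph continuity
equation with an interior solution are again solutions, with convexly controlled action. -/
theorem graphCE_convex_combination
    (n : ℕ) (q : Fin n → Fin n → ℝ) (θ : ℝ → ℝ → ℝ)
    (hG : IsGoodGraph n q) (hθ : IsInterpolation θ)
    (p z : ℝ → Fin n → ℝ) (v u : ℝ → Fin n → Fin n → ℝ)
    (hpv : GraphCE n q θ 1 p v) (hzu : GraphCE n q θ 1 z u)
    (hz : ∀ t ∈ Icc (0:ℝ) 1, z t ∈ probSimplexInt n) :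
    ∀ a ∈ Ioo (0:ℝ) 1,
      ∃ va, GraphCE n q θ 1 (fun t => (1 - a) • p t + a • z t) va ∧
        ∀ t ∈ Icc (0:ℝ) 1,
          tanNormSq n q θ ((1 - a) • p t + a • z t) (va t) ≤
            (1 - a) * tanNormSq n q θ (p t) (v t) + a * tanNormSq n q θ (z t) (u t) := by
  rintro a ⟨ha0, ha1⟩
  have ha1' : 0 < 1 - a := sub_pos.2 ha1
  set P : ℝ → Fin n → ℝ := fun t => (1 - a) • p t + a • z t with hP
  have hPpos : ∀ t ∈ Icc (0 : ℝ) 1, ∀ i, 0 < P t i := fun t ht i =>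
    add_pos_of_nonneg_of_pos (mul_nonneg ha1'.le ((hpv.mem t ht).1 i))
      (mul_pos ha0 ((hz t ht).1 i))
  have hθpos : ∀ t ∈ Icc (0 : ℝ) 1, ∀ i j, 0 < θ (P t i) (P t j) := fun t ht i j =>
    hθ.pos _ _ (hPpos t ht i) (hPpos t ht j)
  have hPcont : ContinuousOn P (Icc 0 1) :=
    (hpv.cont.const_smul (1 - a)).add (hzu.cont.const_smul a)
  let cv : Fin n → Fin n → ℝ → ℝ := fun i j =>
    (Icc 0 1).indicator fun t => (1 - a) * θ (p t i) (p t j) / θ (P t i) (P t j)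
  let cu : Fin n → Fin n → ℝ → ℝ := fun i j =>
    (Icc 0 1).indicator fun t => a * θ (z t i) (z t j) / θ (P t i) (P t j)
  let w : ℝ → Fin n → Fin n → ℝ := fun t i j => cv i j t * v t i j + cu i j t * u t i j
  have hcomp : ∀ {y : ℝ → Fin n → ℝ}, ContinuousOn y (Icc 0 1) →
      (∀ t ∈ Icc (0 : ℝ) 1, ∀ i, 0 ≤ y t i) → ∀ i j,
      ContinuousOn (fun t => θ (y t i) (y t j)) (Icc 0 1) := fun hy hy0 i j =>
    hθ.continuousOn_comp (continuousOn_pi.1 hy i) (continuousOn_pi.1 hy j)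
      (fun t ht => hy0 t ht i) (fun t ht => hy0 t ht j)
  have hden := hcomp hPcont fun t ht i => (hPpos t ht i).le
  have hcv : ∀ i j, Measurable (cv i j) := fun i j =>
    measurable_indicator_of_continuousOn
      ((continuousOn_const.mul (hcomp hpv.cont (fun t ht => (hpv.mem t ht).1) i j)).div
        (hden i j) fun t ht => (hθpos t ht i j).ne') measurableSet_Icc
  have hcu : ∀ i j, Measurable (cu i j) := fun i j =>
    measurable_indicator_of_continuousOn
      ((continuousOn_const.mul (hcomp hzu.cont (fun t ht => (hzu.mem t ht).1) i j)).div
        (hden i j) fun t ht => (hθpos t ht i j).ne') measurableSet_Icc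
  have hwval : ∀ t ∈ Icc (0 : ℝ) 1, ∀ i j, w t i j =
      ((1 - a) * θ (p t i) (p t j) * v t i j + a * θ (z t i) (z t j) * u t i j) /
        θ (P t i) (P t j) := by
    intro t ht i j
    simp only [w, cv, cu, indicator_of_mem ht]
    ring
  refine ⟨w, hpv.convexCombination hθ hzu ha0.le ha1.le
    (fun i j => ((hcv i j).mul (hpv.meas i j)).add ((hcu i j).mul (hzu.meas i j)))
    fun t ht i j => ?_, fun t ht => ?_⟩
  · change θ (P t i) (P t j) * w t i j = _
    rw [hwval t ht, mul_div_cancel₀ _ (hθpos t ht i j).ne']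
    ring
  · change (1 / 2) * ∑ i, ∑ j, (w t i j) ^ 2 * θ (P t i) (P t j) * q i j ≤ _
    have hedge : ∀ i j, (w t i j) ^ 2 * θ (P t i) (P t j) * q i j ≤
        (1 - a) * ((v t i j) ^ 2 * θ (p t i) (p t j) * q i j) +
          a * ((u t i j) ^ 2 * θ (z t i) (z t j) * q i j) := by
      intro i j
      have hp0 := (hpv.mem t ht).1
      have hz0 := (hzu.mem t ht).1
      have hle := sq_div_mul_le (x := v t i j) (y := u t i j)
        (mul_nonneg ha1'.le (hθ.nonneg _ _ (hp0 i) (hp0 j)))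
        (mul_nonneg ha0.le (hθ.nonneg _ _ (hz0 i) (hz0 j))) (hθpos t ht i j)
        (hθ.concave_le ha0.le ha1.le (hp0 i) (hp0 j) (hz0 i) (hz0 j))
      rw [hwval t ht]
      refine (mul_le_mul_of_nonneg_right hle (hG.nonneg i j)).trans_eq ?_
      ring
    calc (1 / 2) * ∑ i, ∑ j, (w t i j) ^ 2 * θ (P t i) (P t j) * q i j
        ≤ (1 / 2) * ∑ i, ∑ j, ((1 - a) * ((v t i j) ^ 2 * θ (p t i) (p t j) * q i j) +
          a * ((u t i j) ^ 2 * θ (z t i) (z t j) * q i j)) :=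
          mul_le_mul_of_nonneg_left
            (Finset.sum_le_sum fun i _ => Finset.sum_le_sum fun j _ => hedge i j) (by norm_num)
      _ = (1 - a) * tanNormSq n q θ (p t) (v t) + a * tanNormSq n q θ (z t) (u t) := by
          simp only [tanNormSq, Finset.sum_add_distrib, ← Finset.mul_sum]
          ring

end VVOT

end
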